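/- arXiv:2510.02372 — 2 statements merged into one kernel-verified Lean document; each statement's English description precedes it below -/
import Mathlib

section
/- For a family of real symmetric r×r matrices A_1,…,A_n (with entries A_β(i,j) = ζ_{ij}^β), the following inequality holds: ∑_{β=1}^n ∑_{1≤i<j≤r} (ζ_{ii}^β − ζ_{jj}^β)² + 2r ∑_{β=1}^n ∑_{1≤i<j≤r} (ζ_{ij}^β)² ≥ 2r · ( ∑_{1≤β<γ≤n} ∑_{1≤i<j≤r} ( ∑_{k=1}^r (ζ_{jk}^β ζ_{ik}^γ − ζ_{ik}^β ζ_{jk}^γ) )² )^{1/2}. -/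
open Finset

/-- The Frobenius inner product of two real matrices. -/
noncomputable def frob {r : ℕ} (X Y : Matrix (Fin r) (Fin r) ℝ) : ℝ := ∑ i, ∑ j, X i j * Y i j

/-- The commutator. -/
noncomputable def cmt {r : ℕ} (X Y : Matrix (Fin r) (Fin r) ℝ) : Matrix (Fin r) (Fin r) ℝ :=
  X * Y - Y * X

lemma frob_eq_trace {r : ℕ} (X Y : Matrix (Fin r) (Fin r) ℝ) :
    frob X Y = (X * Y.transpose).trace := by
  simp [frob, Matrix.trace, Matrix.mul_apply]

lemma frob_self_nonneg {r : ℕ} (X : Matrix (Fin r) (Fin r) ℝ) : 0 ≤ frob X X :=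
  sum_nonneg fun _ _ => sum_nonneg fun _ _ => mul_self_nonneg _

lemma frob_self_eq_zero {r : ℕ} {X : Matrix (Fin r) (Fin r) ℝ} (h : frob X X = 0) : X = 0 := by
  unfold frob at h
  ext i j
  have h1 := (sum_eq_zero_iff_of_nonneg
    (fun i _ => sum_nonneg fun j _ => mul_self_nonneg (X i j))).1 h i (mem_univ _)
  have h2 := (sum_eq_zero_iff_of_nonneg (fun j _ => mul_self_nonneg (X i j))).1 h1 j (mem_univ _)
  simpa using h2

lemma frob_smul {r : ℕ} (a b : ℝ) (X Y : Matrix (Fin r) (Fin r) ℝ) :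
    frob (a • X) (b • Y) = a * b * frob X Y := by
  simp only [frob, Matrix.smul_apply, smul_eq_mul, mul_sum]
  exact sum_congr rfl fun i _ => sum_congr rfl fun j _ => by ring

lemma frob_sum {r : ℕ} {ι κ : Type*} (s : Finset ι) (t : Finset κ)
    (X : ι → Matrix (Fin r) (Fin r) ℝ) (Y : κ → Matrix (Fin r) (Fin r) ℝ) :
    frob (∑ a ∈ s, X a) (∑ b ∈ t, Y b) = ∑ a ∈ s, ∑ b ∈ t, frob (X a) (Y b) := by
  simp only [frob_eq_trace, Matrix.transpose_sum, Matrix.sum_mul, Matrix.mul_sum, Matrix.trace_sum]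
  exact sum_comm

lemma frob_conj {r : ℕ} (U X Y : Matrix (Fin r) (Fin r) ℝ) (hU : U * U.transpose = 1) :
    frob (U.transpose * X * U) (U.transpose * Y * U) = frob X Y := by
  rw [frob_eq_trace, frob_eq_trace]
  have : U.transpose * X * U * (U.transpose * Y * U).transpose
      = U.transpose * (X * (U * U.transpose) * Y.transpose * U) := by
    simp only [Matrix.transpose_mul, Matrix.transpose_transpose, Matrix.mul_assoc]
  rw [this, Matrix.trace_mul_comm, hU, Matrix.mul_one, Matrix.mul_assoc, hU, Matrix.mul_one]

lemma cmt_conj {r : ℕ} (U X Y : Matrix (Fin r) (Fin r) ℝ) (hU : U * U.transpose = 1) :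
    cmt (U.transpose * X * U) (U.transpose * Y * U) = U.transpose * cmt X Y * U := by
  have h : ∀ P Q : Matrix (Fin r) (Fin r) ℝ,
      U.transpose * P * U * (U.transpose * Q * U) = U.transpose * (P * Q) * U := by
    intro P Q
    calc _ = U.transpose * P * (U * U.transpose) * Q * U := by simp only [Matrix.mul_assoc]
      _ = _ := by rw [hU]; simp only [Matrix.mul_assoc, Matrix.one_mul]
  rw [cmt, cmt, h, h, Matrix.mul_sub, Matrix.sub_mul]

lemma real_spectral {r : ℕ} (A : Matrix (Fin r) (Fin r) ℝ) (hA : A.transpose = A) :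
    ∃ (U : Matrix (Fin r) (Fin r) ℝ) (d : Fin r → ℝ), U * U.transpose = 1 ∧
      U.transpose * A * U = Matrix.diagonal d := by
  have hH : A.IsHermitian := by
    rw [Matrix.IsHermitian, Matrix.conjTranspose_eq_transpose_of_trivial, hA]
  have h := hH.conjStarAlgAut_star_eigenvectorUnitary
  refine ⟨(hH.eigenvectorUnitary : Matrix _ _ ℝ), hH.eigenvalues, ?_, ?_⟩
  · have := (Matrix.mem_unitaryGroup_iff).1 hH.eigenvectorUnitary.2
    simpa [Matrix.star_eq_conjTranspose, Matrix.conjTranspose_eq_transpose_of_trivial] using this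
  · rw [Unitary.conjStarAlgAut_apply] at h
    simpa [Matrix.star_eq_conjTranspose, Matrix.conjTranspose_eq_transpose_of_trivial,
      Function.comp_def] using h

/-- Anderson-Morley type bound: a Laplacian with `k` edges has top eigenvalue at most `k + 1`. -/
lemma graph_bound {r : ℕ} (l : Fin r → ℝ) (hl : ∑ i, l i ^ 2 ≤ 1)
    (E : Finset (Fin r × Fin r)) (hE : ∀ p ∈ E, p.1 < p.2) :
    ∑ p ∈ E, (l p.1 - l p.2) ^ 2 ≤ (E.card : ℝ) + 1 := by
  set S := ∑ p ∈ E, (l p.1 - l p.2) ^ 2 with hS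
  set y : Fin r × Fin r → ℝ := fun p => l p.1 - l p.2 with hy
  set d : Fin r × Fin r → Fin r → ℝ :=
    fun p v => (if v = p.1 then 1 else 0) - (if v = p.2 then 1 else 0) with hd
  set M : Fin r × Fin r → Fin r × Fin r → ℝ := fun p q => ∑ v, d p v * d q v with hM
  have hyd : ∀ p, y p = ∑ v, l v * d p v := by
    intro p
    simp [hy, hd, mul_sub, sum_sub_distrib]
  have hS1 : S = ∑ v, l v * ∑ p ∈ E, y p * d p v := by
    simp only [mul_sum]
    rw [sum_comm, hS]
    refine sum_congr rfl fun p _ => ?_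
    change y p ^ 2 = _
    rw [pow_two]
    nth_rewrite 1 [hyd p]
    rw [sum_mul]
    exact sum_congr rfl fun v _ => by ring
  have hS2 : S ^ 2 ≤ ∑ v, (∑ p ∈ E, y p * d p v) ^ 2 := by
    have h := sum_mul_sq_le_sq_mul_sq univ l (fun v => ∑ p ∈ E, y p * d p v)
    rw [← hS1] at h
    refine h.trans ?_
    have h0 : 0 ≤ ∑ v, (∑ p ∈ E, y p * d p v) ^ 2 := sum_nonneg fun _ _ => sq_nonneg _
    nlinarith
  have hS3 : ∑ v, (∑ p ∈ E, y p * d p v) ^ 2 = ∑ p ∈ E, ∑ q ∈ E, y p * y q * M p q := by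
    simp only [pow_two, sum_mul_sum, hM]
    simp only [mul_sum]
    rw [sum_comm]
    refine sum_congr rfl fun p _ => ?_
    rw [sum_comm]
    exact sum_congr rfl fun q _ => sum_congr rfl fun v _ => by ring
  have hMb : ∀ p ∈ E, ∀ q ∈ E, |M p q| ≤ 1 + if p = q then 1 else 0 := by
    intro p hp q hq
    have h1 := hE p hp
    have h2 := hE q hq
    have hMe : M p q = ((if p.1 = q.1 then 1 else 0) - (if p.1 = q.2 then 1 else 0))
        - ((if p.2 = q.1 then 1 else 0) - (if p.2 = q.2 then 1 else 0)) := by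
      simp [hM, hd, sub_mul, sum_sub_distrib]
    have hpq : p = q ↔ p.1 = q.1 ∧ p.2 = q.2 := Prod.ext_iff
    rw [hMe]
    split_ifs <;> simp only [hpq] at * <;> first | (exfalso; omega) | norm_num
  have hS4 : ∑ p ∈ E, ∑ q ∈ E, y p * y q * M p q ≤ ((E.card : ℝ) + 1) * S := by
    calc ∑ p ∈ E, ∑ q ∈ E, y p * y q * M p q
        ≤ ∑ p ∈ E, ∑ q ∈ E, ((y p ^ 2 + y q ^ 2) / 2) * (1 + if p = q then 1 else 0) := by
          refine sum_le_sum fun p hp => sum_le_sum fun q hq => ?_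
          calc y p * y q * M p q ≤ |y p * y q * M p q| := le_abs_self _
            _ = |y p * y q| * |M p q| := abs_mul _ _
            _ ≤ _ := by
              refine mul_le_mul ?_ (hMb p hp q hq) (abs_nonneg _) (by positivity)
              rw [abs_le]
              constructor <;> nlinarith [sq_nonneg (y p + y q), sq_nonneg (y p - y q)]
      _ = ((E.card : ℝ) + 1) * S := by
          have hSy : ∑ p ∈ E, y p ^ 2 = S := rfl
          simp only [mul_add, mul_one, sum_add_distrib, mul_ite, mul_zero, sum_ite_eq, add_div,
            sum_const, ← sum_div, ← smul_sum, hSy, nsmul_eq_mul]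
          rw [sum_congr rfl (fun p hp => if_pos hp)]
          simp only [sum_add_distrib, ← sum_div, ← mul_sum, hSy]
          ring
  have h0 : 0 ≤ S := sum_nonneg fun _ _ => sq_nonneg _
  by_contra hcon
  push Not at hcon
  have : S ^ 2 ≤ ((E.card : ℝ) + 1) * S := hS2.trans (hS3 ▸ hS4)
  have hc : (0 : ℝ) ≤ E.card := Nat.cast_nonneg _
  nlinarith

lemma sum_symm_lt {r : ℕ} (f : Fin r → Fin r → ℝ) (hs : ∀ i j, f i j = f j i)
    (h0 : ∀ i, f i i = 0) :
    ∑ i, ∑ j, f i j = 2 * ∑ i, ∑ j, if i < j then f i j else 0 := by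
  have h : ∀ i j, f i j = (if i < j then f i j else 0) + (if j < i then f j i else 0) := by
    intro i j
    rcases lt_trichotomy i j with h | h | h
    · simp [h, h.not_gt]
    · subst h; simp [h0]
    · simp [h, h.not_gt, hs i j]
  calc ∑ i, ∑ j, f i j
      = ∑ i, ∑ j, ((if i < j then f i j else 0) + (if j < i then f j i else 0)) :=
        sum_congr rfl fun i _ => sum_congr rfl fun j _ => h i j
    _ = _ := by
      simp only [sum_add_distrib]
      rw [sum_comm (f := fun i j => if j < i then f j i else 0)]
      ring

lemma bessel {r : ℕ} {ι : Type*} [DecidableEq ι] (J : Finset ι)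
    (B : ι → Matrix (Fin r) (Fin r) ℝ)
    (hB : ∀ b i j, B b i j = B b j i)
    (ho : ∀ b ∈ J, ∀ c ∈ J, frob (B b) (B c) = if b = c then 1 else 0)
    (i j : Fin r) (hij : i ≠ j) : ∑ b ∈ J, B b i j ^ 2 ≤ 1 / 2 := by
  set s := ∑ b ∈ J, B b i j ^ 2 with hs
  set X : Matrix (Fin r) (Fin r) ℝ := ∑ b ∈ J, B b i j • B b with hX
  have h1 : frob X X = s := by
    rw [hX, frob_sum, hs]
    refine sum_congr rfl fun b hb => ?_
    simp only [frob_smul]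
    rw [sum_congr rfl (fun c hc => by rw [ho b hb c hc])]
    simp [hb, pow_two]
  have hXij : X i j = s := by
    simp [hX, Matrix.sum_apply, hs, pow_two]
  have hXji : X j i = s := by
    simp only [hX, Matrix.sum_apply, hs, pow_two, Matrix.smul_apply, smul_eq_mul]
    exact sum_congr rfl fun b _ => by rw [hB b j i]
  have h2 : X i j * X i j + X j i * X j i ≤ frob X X := by
    unfold frob
    rw [← Fintype.sum_prod_type' (f := fun a b => X a b * X a b)]
    have hne : (i, j) ≠ (j, i) := by simp [hij]
    rw [← sum_pair (f := fun p : Fin r × Fin r => X p.1 p.2 * X p.1 p.2) hne]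
    exact sum_le_sum_of_subset_of_nonneg (subset_univ _) fun _ _ _ => mul_self_nonneg _
  rw [hXij, hXji, h1] at h2
  have : 0 ≤ s := sum_nonneg fun _ _ => sq_nonneg _
  by_contra hc
  push Not at hc
  nlinarith

lemma key_diag {r : ℕ} {ι : Type*} [DecidableEq ι] (l : Fin r → ℝ) (hl : ∑ i, l i ^ 2 ≤ 1)
    (J : Finset ι) (B : ι → Matrix (Fin r) (Fin r) ℝ)
    (hB : ∀ b i j, B b i j = B b j i)
    (ho : ∀ b ∈ J, ∀ c ∈ J, frob (B b) (B c) = if b = c then 1 else 0) :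
    ∑ b ∈ J, ∑ i, ∑ j, (l i - l j) ^ 2 * B b i j ^ 2 ≤ (J.card : ℝ) + 1 := by
  set w : Fin r → Fin r → ℝ := fun i j => max ((l i - l j) ^ 2 - 1) 0 with hw
  have hcard : (J.card : ℝ) = ∑ b ∈ J, ∑ i, ∑ j, B b i j ^ 2 := by
    rw [card_eq_sum_ones]
    push_cast
    refine sum_congr rfl fun b hb => ?_
    have := ho b hb b hb
    simp only [if_true, frob] at this
    simp only [← this, pow_two]
  have h1 : ∑ b ∈ J, ∑ i, ∑ j, (l i - l j) ^ 2 * B b i j ^ 2 - J.card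
      = ∑ i, ∑ j, ((l i - l j) ^ 2 - 1) * ∑ b ∈ J, B b i j ^ 2 := by
    rw [hcard, ← sum_sub_distrib]
    simp only [← sum_sub_distrib, mul_sum]
    rw [sum_comm]
    refine sum_congr rfl fun i _ => ?_
    rw [sum_comm]
    exact sum_congr rfl fun j _ => sum_congr rfl fun b _ => by ring
  have h2 : ∑ i, ∑ j, ((l i - l j) ^ 2 - 1) * ∑ b ∈ J, B b i j ^ 2
      ≤ ∑ i, ∑ j, w i j / 2 := by
    refine sum_le_sum fun i _ => sum_le_sum fun j _ => ?_
    have hs : 0 ≤ ∑ b ∈ J, B b i j ^ 2 := sum_nonneg fun _ _ => sq_nonneg _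
    have hw0 : 0 ≤ w i j := le_max_right _ _
    by_cases hij : i = j
    · subst hij
      simp only [sub_self]
      nlinarith
    · have hb := bessel J B hB ho i j hij
      have hw1 : (l i - l j) ^ 2 - 1 ≤ w i j := le_max_left _ _
      nlinarith
  have h3 : ∑ i, ∑ j, w i j / 2 = ∑ i, ∑ j, if i < j then w i j else 0 := by
    have := sum_symm_lt w (fun i j => by simp only [hw]; congr 2; ring) (fun i => by simp [hw])
    simp only [← sum_div]
    rw [this]; ring
  have h4 : (∑ i, ∑ j, if i < j then w i j else 0) ≤ 1 := by
    set E : Finset (Fin r × Fin r) :=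
      univ.filter fun p => p.1 < p.2 ∧ 1 < (l p.1 - l p.2) ^ 2 with hE
    have hg := graph_bound l hl E (fun p hp => (mem_filter.1 hp).2.1)
    have he : (∑ i, ∑ j, if i < j then w i j else 0)
        = ∑ p ∈ E, ((l p.1 - l p.2) ^ 2 - 1) := by
      rw [← Fintype.sum_prod_type' (f := fun i j => if i < j then w i j else 0), hE, sum_filter]
      refine sum_congr rfl fun p _ => ?_
      by_cases hp : p.1 < p.2
      · by_cases hq : 1 < (l p.1 - l p.2) ^ 2
        · simp only [hp, hq, if_true, hw, and_self]
          exact max_eq_left (by linarith)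
        · simp only [hp, hq, if_true, hw, and_false, if_false]
          exact max_eq_right (by linarith)
      · simp [hp]
    rw [he, sum_sub_distrib]
    simp only [sum_const, nsmul_eq_mul, mul_one]
    linarith
  linarith

lemma key {r : ℕ} {ι : Type*} [DecidableEq ι] (A : Matrix (Fin r) (Fin r) ℝ)
    (hA : A.transpose = A) (hA1 : frob A A = 1)
    (J : Finset ι) (B : ι → Matrix (Fin r) (Fin r) ℝ)
    (hB : ∀ b, (B b).transpose = B b)
    (ho : ∀ b ∈ J, ∀ c ∈ J, frob (B b) (B c) = if b = c then 1 else 0) :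
    ∑ b ∈ J, frob (cmt A (B b)) (cmt A (B b)) ≤ (J.card : ℝ) + 1 := by
  obtain ⟨U, d, hU, hd⟩ := real_spectral A hA
  have h1 : ∑ i, d i ^ 2 ≤ 1 := by
    rw [← hA1, ← frob_conj U A A hU, hd]
    simp [frob, Matrix.diagonal_apply, pow_two]
  have h2 := key_diag d h1 J (fun b => U.transpose * B b * U)
    (fun b i j => by
      have : (U.transpose * B b * U).transpose = U.transpose * B b * U := by
        simp [Matrix.transpose_mul, hB, Matrix.mul_assoc]
      exact congrFun (congrFun this j) i)
    (fun b hb c hc => by rw [frob_conj U _ _ hU, ho b hb c hc])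
  refine le_of_eq_of_le (sum_congr rfl fun b _ => ?_) h2
  rw [← frob_conj U _ _ hU, ← cmt_conj U _ _ hU, hd, frob]
  refine sum_congr rfl fun i _ => sum_congr rfl fun j _ => ?_
  simp only [cmt, Matrix.sub_apply, Matrix.diagonal_mul, Matrix.mul_diagonal]
  ring

lemma cmt_smul {r : ℕ} (a b : ℝ) (X Y : Matrix (Fin r) (Fin r) ℝ) :
    cmt (a • X) (b • Y) = (a * b) • cmt X Y := by
  simp only [cmt, smul_sub, Matrix.smul_mul, Matrix.mul_smul, smul_smul, mul_comm b a]

lemma ddvv_orth {r n : ℕ} (A : Fin n → Matrix (Fin r) (Fin r) ℝ)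
    (hA : ∀ b, (A b).transpose = A b) (ho : ∀ b c, b ≠ c → frob (A b) (A c) = 0) :
    ∑ b, ∑ c, frob (cmt (A b) (A c)) (cmt (A b) (A c)) ≤ (∑ b, frob (A b) (A b)) ^ 2 := by
  set x : Fin n → ℝ := fun b => frob (A b) (A b) with hx
  set C : Fin n → Fin n → ℝ := fun b c => frob (cmt (A b) (A c)) (cmt (A b) (A c)) with hC
  have hx0 : ∀ b, 0 ≤ x b := fun b => frob_self_nonneg _
  have hxz : ∀ b, x b = 0 → A b = 0 := fun b h => frob_self_eq_zero h
  set e : Fin n → Fin n → ℝ := fun b c => max (C b c / (x b * x c) - 1) 0 with he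
  have he0 : ∀ b c, 0 ≤ e b c := fun b c => le_max_right _ _
  have hCsymm : ∀ b c, C b c = C c b := by
    intro b c
    have : cmt (A b) (A c) = (-1 : ℝ) • cmt (A c) (A b) := by simp [cmt]
    simp only [hC]
    rw [this, frob_smul]; ring
  have hesymm : ∀ b c, e b c = e c b := by
    intro b c
    simp only [he]; rw [hCsymm b c, mul_comm (x b)]
  have hCe : ∀ b c, C b c ≤ x b * x c + e b c * (x b * x c) := by
    intro b c
    by_cases h : x b * x c = 0
    · have : C b c = 0 := by
        rcases mul_eq_zero.1 h with h | h <;> simp [hC, hxz _ h, cmt, frob]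
      rw [this, h]; simp
    · have hp : 0 < x b * x c := lt_of_le_of_ne (mul_nonneg (hx0 b) (hx0 c)) (Ne.symm h)
      have h1 : C b c / (x b * x c) - 1 ≤ e b c := le_max_left _ _
      have h2 : C b c / (x b * x c) ≤ 1 + e b c := by linarith
      rw [div_le_iff₀ hp] at h2
      linarith
  have hCd : ∀ b, C b b = 0 := fun b => by simp [hC, cmt, frob]
  have hed : ∀ b, e b b = 0 := fun b => by simp [he, hCd]
  have hrow : ∀ b, ∑ c, e b c ≤ 1 := by
    intro b
    set J : Finset (Fin n) := univ.filter fun c => 1 < C b c / (x b * x c) with hJ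
    have hs : ∑ c, e b c = ∑ c ∈ J, (C b c / (x b * x c) - 1) := by
      rw [hJ, sum_filter]
      refine sum_congr rfl fun c _ => ?_
      split_ifs with h
      · exact max_eq_left (by linarith)
      · exact max_eq_right (by linarith)
    rw [hs]
    rcases J.eq_empty_or_nonempty with hJe | ⟨c0, hc0⟩
    · simp [hJe]
    have hne : ∀ c ∈ J, x b ≠ 0 ∧ x c ≠ 0 := by
      intro c hc
      have := (mem_filter.1 hc).2
      constructor <;> intro h <;> rw [h] at this <;> norm_num at this
    have hsq : ∀ c, x c ≠ 0 → (Real.sqrt (x c))⁻¹ * (Real.sqrt (x c))⁻¹ * x c = 1 := by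
      intro c hc
      rw [← mul_inv, Real.mul_self_sqrt (hx0 c), inv_mul_cancel₀ hc]
    have hsq2 : ∀ c, (Real.sqrt (x c))⁻¹ * (Real.sqrt (x c))⁻¹ = (x c)⁻¹ := by
      intro c
      rw [← mul_inv, Real.mul_self_sqrt (hx0 c)]
    have hk := key ((Real.sqrt (x b))⁻¹ • A b) (by rw [Matrix.transpose_smul, hA])
      (by rw [frob_smul]; exact hsq b (hne c0 hc0).1) J
      (fun c => (Real.sqrt (x c))⁻¹ • A c) (fun c => by rw [Matrix.transpose_smul, hA])
      (by
        intro c hc d hd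
        rw [frob_smul]
        split_ifs with h
        · subst h; exact hsq c (hne c hc).2
        · rw [ho c d h, mul_zero])
    rw [sum_sub_distrib]
    simp only [sum_const, nsmul_eq_mul, mul_one]
    have : ∑ c ∈ J, C b c / (x b * x c) = ∑ c ∈ J, frob (cmt ((Real.sqrt (x b))⁻¹ • A b)
        ((Real.sqrt (x c))⁻¹ • A c)) (cmt ((Real.sqrt (x b))⁻¹ • A b)
        ((Real.sqrt (x c))⁻¹ • A c)) := by
      refine sum_congr rfl fun c _ => ?_
      rw [cmt_smul, frob_smul]
      change _ = _ * C b c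
      rw [mul_mul_mul_comm, hsq2, hsq2, div_eq_mul_inv, mul_inv, mul_comm]
    linarith
  have hpt : ∀ b c, C b c ≤ x b * x c - (if b = c then x b ^ 2 else 0)
      + (e b c * x b ^ 2 / 2 + e c b * x c ^ 2 / 2) := by
    intro b c
    split_ifs with h
    · subst h; rw [hCd, hed]; nlinarith
    · have h1 := hCe b c
      have h2 := mul_nonneg (he0 b c) (sq_nonneg (x b - x c))
      rw [hesymm c b]
      nlinarith
  calc ∑ b, ∑ c, C b c
      ≤ ∑ b, ∑ c, (x b * x c - (if b = c then x b ^ 2 else 0)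
        + (e b c * x b ^ 2 / 2 + e c b * x c ^ 2 / 2)) :=
        sum_le_sum fun b _ => sum_le_sum fun c _ => hpt b c
    _ = (∑ b, x b) ^ 2 - ∑ b, x b ^ 2 + ∑ b, (∑ c, e b c) * x b ^ 2 := by
        simp only [sum_add_distrib, sum_sub_distrib]
        rw [sum_comm (f := fun b c => e c b * x c ^ 2 / 2)]
        simp only [sum_ite_eq, mem_univ, if_true, pow_two (∑ b, x b), sum_mul_sum, ← sum_div,
          ← sum_mul]
        ring
    _ ≤ (∑ b, x b) ^ 2 := by
        have : ∑ b, (∑ c, e b c) * x b ^ 2 ≤ ∑ b, x b ^ 2 :=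
          sum_le_sum fun b _ => by nlinarith [hrow b, sq_nonneg (x b)]
        linarith

lemma rot_frob {r n : ℕ} (U : Matrix (Fin n) (Fin n) ℝ) (hU : U * U.transpose = 1)
    (X : Fin n → Matrix (Fin r) (Fin r) ℝ) :
    ∑ a, frob (∑ b, U b a • X b) (∑ b, U b a • X b) = ∑ b, frob (X b) (X b) := by
  simp only [frob_sum, frob_smul]
  rw [sum_comm]
  refine sum_congr rfl fun b _ => ?_
  rw [sum_comm]
  have h : ∀ c, ∑ a, U b a * U c a * frob (X b) (X c)
      = (if b = c then 1 else 0) * frob (X b) (X c) := by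
    intro c
    rw [← sum_mul]
    congr 1
    have := congrFun (congrFun hU b) c
    simpa [Matrix.mul_apply, Matrix.one_apply] using this
  simp [h]

lemma cmt_sum_left {r n : ℕ} (u : Fin n → ℝ) (X : Fin n → Matrix (Fin r) (Fin r) ℝ)
    (Y : Matrix (Fin r) (Fin r) ℝ) :
    cmt (∑ b, u b • X b) Y = ∑ b, u b • cmt (X b) Y := by
  simp [cmt, Matrix.sum_mul, Matrix.mul_sum, smul_sub, sum_sub_distrib]

lemma cmt_sum_right {r n : ℕ} (u : Fin n → ℝ) (X : Fin n → Matrix (Fin r) (Fin r) ℝ)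
    (Y : Matrix (Fin r) (Fin r) ℝ) :
    cmt Y (∑ b, u b • X b) = ∑ b, u b • cmt Y (X b) := by
  simp [cmt, Matrix.sum_mul, Matrix.mul_sum, smul_sub, sum_sub_distrib]

lemma ddvv {r n : ℕ} (A : Fin n → Matrix (Fin r) (Fin r) ℝ)
    (hA : ∀ b, (A b).transpose = A b) :
    ∑ b, ∑ c, frob (cmt (A b) (A c)) (cmt (A b) (A c)) ≤ (∑ b, frob (A b) (A b)) ^ 2 := by
  set G : Matrix (Fin n) (Fin n) ℝ := Matrix.of fun b c => frob (A b) (A c) with hG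
  have hGs : G.transpose = G := by
    ext b c
    simp [hG, frob, mul_comm]
  obtain ⟨U, d, hU, hd⟩ := real_spectral G hGs
  have h := ddvv_orth (fun a => ∑ b, U b a • A b)
    (fun a => by simp [Matrix.transpose_sum, hA])
    (fun a c hac => by
      have h1 : (U.transpose * G * U) a c = 0 := by rw [hd]; simp [hac]
      rw [← h1, Matrix.mul_assoc]
      simp only [frob_sum, frob_smul, Matrix.mul_apply, Matrix.transpose_apply, mul_sum, hG,
        Matrix.of_apply]
      exact sum_congr rfl fun i _ => sum_congr rfl fun j _ => by ring)
  rw [rot_frob U hU] at h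
  refine le_of_eq_of_le ?_ h
  have h1 : ∀ a, ∑ c, frob (cmt (∑ b, U b a • A b) (∑ b, U b c • A b))
      (cmt (∑ b, U b a • A b) (∑ b, U b c • A b))
      = ∑ c, frob (cmt (∑ b, U b a • A b) (A c)) (cmt (∑ b, U b a • A b) (A c)) := by
    intro a
    simp only [cmt_sum_right (fun b => U b _) A]
    exact rot_frob U hU _
  simp only [h1]
  rw [sum_comm]
  conv_rhs => rw [sum_comm]
  refine sum_congr rfl fun c _ => ?_
  simp only [cmt_sum_left (fun b => U b _) A]
  exact (rot_frob U hU _).symm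

/-- Lu's lemma (Lemma 2 of the paper): the algebraic DDVV inequality for a
family of symmetric matrices with entries `ζ β i j`. -/
theorem stmt1 (r n : ℕ) (hr : 2 ≤ r) (hn : 1 ≤ n)
    (ζ : Fin n → Fin r → Fin r → ℝ)
    (hsym : ∀ β i j, ζ β i j = ζ β j i) :
    (∑ β : Fin n, ∑ i : Fin r, ∑ j : Fin r,
        if i < j then (ζ β i i - ζ β j j) ^ 2 else 0)
      + 2 * (r : ℝ) * (∑ β : Fin n, ∑ i : Fin r, ∑ j : Fin r,
          if i < j then (ζ β i j) ^ 2 else 0)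
    ≥ 2 * (r : ℝ) * Real.sqrt
        (∑ β : Fin n, ∑ γ : Fin n, if β < γ then
          ∑ i : Fin r, ∑ j : Fin r, if i < j then
            (∑ k : Fin r, (ζ β j k * ζ γ i k - ζ β i k * ζ γ j k)) ^ 2
          else 0
        else 0) := by
  set Z : Fin n → Matrix (Fin r) (Fin r) ℝ := fun β => Matrix.of (ζ β) with hZ
  set t : Fin n → ℝ := fun β => (∑ i, ζ β i i) / r with ht
  set A : Fin n → Matrix (Fin r) (Fin r) ℝ := fun β => Z β - t β • 1 with hA
  have hr0 : (0 : ℝ) < r := by exact_mod_cast (by omega : 0 < r)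
  have hAs : ∀ β, (A β).transpose = A β := by
    intro β
    have : (Z β).transpose = Z β := by
      ext i j
      exact hsym β j i
    simp [hA, this]
  have hd := ddvv A hAs
  have hcm : ∀ β γ, cmt (A β) (A γ) = cmt (Z β) (Z γ) := by
    intro β γ
    simp only [cmt, hA, sub_mul, mul_sub, Matrix.smul_mul, Matrix.mul_smul, Matrix.one_mul,
      Matrix.mul_one, smul_smul]
    rw [mul_comm (t γ) (t β)]
    abel
  simp only [hcm] at hd
  -- entries of the commutators
  have hent : ∀ β γ i j, (∑ k : Fin r, (ζ β j k * ζ γ i k - ζ β i k * ζ γ j k)) ^ 2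
      = cmt (Z β) (Z γ) i j * cmt (Z β) (Z γ) i j := by
    intro β γ i j
    have : cmt (Z β) (Z γ) i j = -∑ k : Fin r, (ζ β j k * ζ γ i k - ζ β i k * ζ γ j k) := by
      simp only [cmt, hZ, Matrix.sub_apply, Matrix.mul_apply, Matrix.of_apply, sum_sub_distrib,
        neg_sub]
      congr 1
      · exact sum_congr rfl fun k _ => by rw [hsym γ k j]
      · exact sum_congr rfl fun k _ => by rw [hsym β k j]; ring
    rw [this]; ring
  set P : Fin n → Fin n → ℝ := fun β γ => ∑ i : Fin r, ∑ j : Fin r, if i < j then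
            (∑ k : Fin r, (ζ β j k * ζ γ i k - ζ β i k * ζ γ j k)) ^ 2
          else 0 with hP
  have hfP : ∀ β γ, frob (cmt (Z β) (Z γ)) (cmt (Z β) (Z γ)) = 2 * P β γ := by
    intro β γ
    have := sum_symm_lt
      (fun i j => (∑ k : Fin r, (ζ β j k * ζ γ i k - ζ β i k * ζ γ j k)) ^ 2)
      (fun i j => by
        rw [← neg_sq, ← sum_neg_distrib]
        congr 1
        exact sum_congr rfl fun k _ => by ring)
      (fun i => by
        rw [sum_eq_zero (fun k _ => by ring)]
        norm_num)
    rw [hP, ← this]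
    simp only [hent, frob]
  have hPP := sum_symm_lt P
    (fun β γ => by
      simp only [hP]
      refine sum_congr rfl fun i _ => sum_congr rfl fun j _ => ?_
      congr 1
      rw [← neg_sq, ← sum_neg_distrib]
      congr 1
      exact sum_congr rfl fun k _ => by ring)
    (fun β => by
      have h := hfP β β
      have h0 : frob (cmt (Z β) (Z β)) (cmt (Z β) (Z β)) = 0 := by simp [cmt, frob]
      linarith)
  simp only [hfP, ← mul_sum] at hd
  rw [hPP] at hd
  set Q := ∑ β : Fin n, ∑ γ : Fin n, if β < γ then P β γ else 0 with hQ
  have hL : ∀ β, r * frob (A β) (A β) = (∑ i : Fin r, ∑ j : Fin r,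
        if i < j then (ζ β i i - ζ β j j) ^ 2 else 0)
      + 2 * (r : ℝ) * (∑ i : Fin r, ∑ j : Fin r, if i < j then (ζ β i j) ^ 2 else 0) := by
    intro β
    have h1 := sum_symm_lt (fun i j => (ζ β i i - ζ β j j) ^ 2) (fun i j => by ring)
      (fun i => by ring)
    have h2 := sum_symm_lt (fun i j => if i = j then 0 else (ζ β i j) ^ 2)
      (fun i j => by rw [hsym β i j]; simp only [eq_comm (a := i) (b := j)])
      (fun i => by simp)
    have h3 : (∑ i : Fin r, ∑ j : Fin r, if i < j then (if i = j then 0 else (ζ β i j) ^ 2) else 0)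
        = ∑ i : Fin r, ∑ j : Fin r, if i < j then (ζ β i j) ^ 2 else 0 := by
      refine sum_congr rfl fun i _ => sum_congr rfl fun j _ => ?_
      by_cases h : i < j
      · simp [h, h.ne]
      · simp [h]
    rw [h3] at h2
    have h4 : ∑ i, ∑ j, (ζ β i i - ζ β j j) ^ 2
        = 2 * r * (∑ i, ζ β i i ^ 2) - 2 * (∑ i, ζ β i i) ^ 2 := by
      have : ∀ i j, (ζ β i i - ζ β j j) ^ 2
          = ζ β i i ^ 2 + ζ β j j ^ 2 - 2 * (ζ β i i * ζ β j j) := fun i j => by ring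
      simp only [this, sum_add_distrib, sum_sub_distrib, ← mul_sum, ← sum_mul, sum_const,
        card_univ, Fintype.card_fin, nsmul_eq_mul]
      ring
    have h5 : frob (A β) (A β) = ∑ i, ∑ j, (if i = j then 0 else (ζ β i j) ^ 2)
        + ∑ i, (ζ β i i - t β) ^ 2 := by
      have : ∀ i, (ζ β i i - t β) ^ 2 = ∑ j, if i = j then (ζ β i i - t β) ^ 2 else 0 := by
        intro i; simp
      rw [sum_congr rfl (fun i _ => this i)]
      rw [← sum_add_distrib, frob]
      refine sum_congr rfl fun i _ => ?_
      rw [← sum_add_distrib]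
      refine sum_congr rfl fun j _ => ?_
      by_cases h : i = j
      · subst h
        simp [hA, hZ, pow_two]
      · simp [hA, hZ, h, pow_two]
    have h6 : r * ∑ i, (ζ β i i - t β) ^ 2 = r * (∑ i, ζ β i i ^ 2) - (∑ i, ζ β i i) ^ 2 := by
      have : ∀ i, (ζ β i i - t β) ^ 2
          = ζ β i i ^ 2 + t β ^ 2 - 2 * t β * ζ β i i := fun i => by ring
      simp only [this, sum_add_distrib, sum_sub_distrib, ← mul_sum, sum_const,
        card_univ, Fintype.card_fin, nsmul_eq_mul]
      have hrt : (∑ i, ζ β i i) = r * t β := by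
        simp only [ht]; field_simp
      rw [hrt]; ring
    rw [h5, mul_add, h6, h2]
    linarith
  have hfin : (∑ β : Fin n, ∑ i : Fin r, ∑ j : Fin r,
        if i < j then (ζ β i i - ζ β j j) ^ 2 else 0)
      + 2 * (r : ℝ) * (∑ β : Fin n, ∑ i : Fin r, ∑ j : Fin r,
          if i < j then (ζ β i j) ^ 2 else 0) = r * ∑ β, frob (A β) (A β) := by
    rw [mul_sum (s := univ) (f := fun β => frob (A β) (A β)), mul_sum (s := univ)
      (a := 2 * (r : ℝ)), ← sum_add_distrib]
    exact sum_congr rfl fun β _ => (hL β).symm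
  rw [hfin, ge_iff_le]
  have hS0 : 0 ≤ ∑ β, frob (A β) (A β) := sum_nonneg fun _ _ => frob_self_nonneg _
  have hsq : Real.sqrt Q ≤ (∑ β, frob (A β) (A β)) / 2 := by
    rw [Real.sqrt_le_left (by positivity)]
    nlinarith
  nlinarith
end

section
/- Let A_1,…,A_n be symmetric real r×r matrices. Then the normalized commutator term satisfies: (2/(r(r−1))) · ( ∑_{1≤β<γ≤n} ∑_{1≤i<j≤r} ([A_γ,A_β])_{ij}² )^{1/2} ≤ (1/(r²(r−1))) · ( ∑_β ∑_{1≤i<j≤r} ((A_β)_{ii} − (A_β)_{jj})² + 2r ∑_β ∑_{1≤i<j≤r} (A_β)_{ij}² ). -/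
open Finset

theorem ddvv_edge {r : ℕ} (η : Fin r → ℝ) (P : Finset (Fin r × Fin r))
    (hP : ∀ e ∈ P, e.1 < e.2) :
    ∑ e ∈ P, (η e.1 - η e.2) ^ 2 ≤ ((#P : ℝ) + 1) * ∑ k, η k ^ 2 := by
  set x : Fin r × Fin r → ℝ := fun e => η e.1 - η e.2 with hx
  set d : Fin r × Fin r → Fin r → ℝ :=
    fun e k => (if k = e.1 then 1 else 0) - (if k = e.2 then 1 else 0) with hd
  set X := ∑ e ∈ P, (x e) ^ 2 with hX
  set S := ∑ k, η k ^ 2 with hS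
  have hX0 : 0 ≤ X := Finset.sum_nonneg fun e _ => sq_nonneg _
  have h1 : ∑ k, η k * (∑ e ∈ P, x e * d e k) = X := by
    simp only [Finset.mul_sum]
    rw [Finset.sum_comm]
    refine Finset.sum_congr rfl fun e _ => ?_
    have : ∀ k, η k * (x e * d e k) = x e * ((if k = e.1 then η k else 0) - (if k = e.2 then η k else 0)) := by
      intro k; simp only [hd]; split_ifs <;> ring
    simp only [this, ← Finset.mul_sum, Finset.sum_sub_distrib]
    simp [hx]; ring
  have h2 : ∑ k, (∑ e ∈ P, x e * d e k) ^ 2 ≤ ((#P : ℝ) + 1) * X := by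
    have e1 : ∑ k, (∑ e ∈ P, x e * d e k) ^ 2
        = ∑ e ∈ P, ∑ f ∈ P, x e * x f * ∑ k, d e k * d f k := by
      simp only [sq, Finset.sum_mul_sum]
      simp only [Finset.mul_sum]
      rw [Finset.sum_comm]
      refine Finset.sum_congr rfl fun e _ => ?_
      rw [Finset.sum_comm]
      refine Finset.sum_congr rfl fun f _ => Finset.sum_congr rfl fun k _ => ?_
      ring
    have e2 : ∀ e ∈ P, ∀ f ∈ P, x e * x f * ∑ k, d e k * d f k
        ≤ |x e| * |x f| + if e = f then x e ^ 2 else 0 := by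
      intro e he f hf
      have hge : ∑ k, d e k * d f k = (if f.1 = e.1 then 1 else 0) - (if f.1 = e.2 then 1 else 0)
          - (if f.2 = e.1 then 1 else 0) + (if f.2 = e.2 then 1 else 0) := by
        simp only [hd, sub_mul, mul_sub, Finset.sum_sub_distrib]
        simp
        ring
      have h1 := hP e he
      have h2 := hP f hf
      by_cases hef : e = f
      · subst hef
        rw [hge, if_pos rfl, if_neg h1.ne, if_neg h1.ne', if_pos rfl, if_pos rfl, abs_mul_abs_self]
        linarith
      · rw [if_neg hef]
        have hg : |∑ k, d e k * d f k| ≤ 1 := by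
          rw [hge]
          obtain ⟨a, b⟩ := e
          obtain ⟨c, d⟩ := f
          simp only [Prod.mk.injEq, not_and] at hef h1 h2 ⊢
          split_ifs <;> first | (exfalso; omega) | norm_num
        calc _ ≤ |x e * x f * ∑ k, d e k * d f k| := le_abs_self _
          _ = |x e| * |x f| * |∑ k, d e k * d f k| := by rw [abs_mul, abs_mul]
          _ ≤ |x e| * |x f| * 1 := by gcongr
          _ = _ := by ring
    rw [e1]
    calc _ ≤ ∑ e ∈ P, ∑ f ∈ P, (|x e| * |x f| + if e = f then x e ^ 2 else 0) :=
          Finset.sum_le_sum fun e he => Finset.sum_le_sum fun f hf => e2 e he f hf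
      _ = (∑ e ∈ P, |x e|) ^ 2 + X := by
          simp only [Finset.sum_add_distrib, sq, Finset.sum_mul_sum, hX]
          congr 1
          refine Finset.sum_congr rfl fun e he => ?_
          simp [he]
      _ ≤ (#P : ℝ) * ∑ e ∈ P, |x e| ^ 2 + X := by
          gcongr
          exact sq_sum_le_card_mul_sum_sq
      _ = _ := by simp only [sq_abs]; ring
  have h3 := Finset.sum_mul_sq_le_sq_mul_sq Finset.univ η (fun k => ∑ e ∈ P, x e * d e k)
  rw [h1] at h3
  have hS0 : 0 ≤ S := Finset.sum_nonneg fun e _ => sq_nonneg _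
  have h4 : X ^ 2 ≤ S * (((#P : ℝ) + 1) * X) := h3.trans (by gcongr)
  rcases hX0.eq_or_lt with h | h
  · rw [← h]; positivity
  · nlinarith

theorem ddvv_sum_symm {r : ℕ} (f : Fin r → Fin r → ℝ) (hf : ∀ i j, f i j = f j i) :
    ∑ i, ∑ j, f i j = ∑ i, f i i + 2 * ∑ i, ∑ j, if i < j then f i j else 0 := by
  have h1 : ∀ i j, f i j = (if i = j then f i j else 0) + (if i < j then f i j else 0)
      + (if j < i then f j i else 0) := by
    intro i j
    rcases lt_trichotomy i j with h | h | h
    · simp [h, h.ne, h.not_gt]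
    · simp [h]
    · simp [h, h.ne', h.not_gt, hf i j]
  have h2 : ∑ i, ∑ j, (if j < i then f j i else 0) = ∑ i, ∑ j, if i < j then f i j else 0 :=
    Finset.sum_comm
  calc _ = ∑ i, ∑ j, ((if i = j then f i j else 0) + (if i < j then f i j else 0)
      + (if j < i then f j i else 0)) :=
        Finset.sum_congr rfl fun i _ => Finset.sum_congr rfl fun j _ => h1 i j
    _ = _ := by
        simp only [Finset.sum_add_distrib, h2]
        simp
        ring

theorem ddvv_weight {r : ℕ} (η : Fin r → ℝ) (R : Fin r → Fin r → ℝ) (K : ℝ) (hK : 0 ≤ K)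
    (hR0 : ∀ i j, 0 ≤ R i j) (hRs : ∀ i j, R i j = R j i) (hRK : ∀ i j, i < j → 2 * R i j ≤ K) :
    ∑ i, ∑ j, (η i - η j) ^ 2 * R i j ≤ (∑ k, η k ^ 2) * (∑ i, ∑ j, R i j + K) := by
  set S := ∑ k, η k ^ 2 with hS
  have hS0 : 0 ≤ S := Finset.sum_nonneg fun e _ => sq_nonneg _
  have key : ∑ i, ∑ j, (if i < j then ((η i - η j) ^ 2 - S) * R i j else 0) ≤ S * K / 2 := by
    rw [← Fintype.sum_prod_type' (f := fun i j => if i < j then ((η i - η j) ^ 2 - S) * R i j else 0)]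
    set P : Finset (Fin r × Fin r) :=
      Finset.univ.filter fun e => e.1 < e.2 ∧ S < (η e.1 - η e.2) ^ 2 with hPd
    have hedge := ddvv_edge η P (fun e he => (Finset.mem_filter.1 he).2.1)
    calc _ ≤ ∑ e : Fin r × Fin r, (if e.1 < e.2 ∧ S < (η e.1 - η e.2) ^ 2 then
            ((η e.1 - η e.2) ^ 2 - S) * (K / 2) else 0) := by
          refine Finset.sum_le_sum fun e _ => ?_
          have := hR0 e.1 e.2
          by_cases h : e.1 < e.2
          · have h3 := hRK _ _ h
            by_cases h2 : S < (η e.1 - η e.2) ^ 2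
            · simp only [h, h2, if_true, and_self]
              nlinarith
            · simp only [h, h2, if_true, and_false, if_false]
              nlinarith
          · simp [h]
      _ = ∑ e ∈ P, ((η e.1 - η e.2) ^ 2 - S) * (K / 2) := by
          rw [hPd, Finset.sum_filter]
      _ = (∑ e ∈ P, (η e.1 - η e.2) ^ 2 - #P * S) * (K / 2) := by
          rw [← Finset.sum_mul, Finset.sum_sub_distrib]; simp
      _ ≤ _ := by nlinarith
  have e1 := ddvv_sum_symm (fun i j => ((η i - η j) ^ 2 - S) * R i j)
    (fun i j => by simp only [hRs i j]; ring)
  have e2 : ∑ i, ((η i - η i) ^ 2 - S) * R i i ≤ 0 :=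
    Finset.sum_nonpos fun i _ => by have := hR0 i i; nlinarith
  have e3 : ∑ i, ∑ j, ((η i - η j) ^ 2 - S) * R i j
      = ∑ i, ∑ j, (η i - η j) ^ 2 * R i j - S * ∑ i, ∑ j, R i j := by
    simp only [sub_mul, Finset.sum_sub_distrib, Finset.mul_sum]
  nlinarith

/-- Frobenius inner product. -/
def ddvvIp {r : ℕ} (X Y : Matrix (Fin r) (Fin r) ℝ) : ℝ := ∑ i, ∑ j, X i j * Y i j

/-- Commutator. -/
def ddvvC {r : ℕ} (X Y : Matrix (Fin r) (Fin r) ℝ) : Matrix (Fin r) (Fin r) ℝ := X * Y - Y * X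

section
variable {r n : ℕ}

theorem ddvvIp_trace (X Y : Matrix (Fin r) (Fin r) ℝ) : ddvvIp X Y = (X.transpose * Y).trace := by
  simp only [ddvvIp, Matrix.trace, Matrix.diag, Matrix.mul_apply, Matrix.transpose_apply]
  exact Finset.sum_comm

theorem ddvvIp_comm (X Y : Matrix (Fin r) (Fin r) ℝ) : ddvvIp X Y = ddvvIp Y X := by
  simp only [ddvvIp, mul_comm]

theorem ddvvIp_add_left (X Y Z : Matrix (Fin r) (Fin r) ℝ) :
    ddvvIp (X + Y) Z = ddvvIp X Z + ddvvIp Y Z := by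
  simp only [ddvvIp, Matrix.add_apply, add_mul, Finset.sum_add_distrib]

theorem ddvvIp_sub_left (X Y Z : Matrix (Fin r) (Fin r) ℝ) :
    ddvvIp (X - Y) Z = ddvvIp X Z - ddvvIp Y Z := by
  simp only [ddvvIp, Matrix.sub_apply, sub_mul, Finset.sum_sub_distrib]

theorem ddvvIp_smul_left (c : ℝ) (X Z : Matrix (Fin r) (Fin r) ℝ) :
    ddvvIp (c • X) Z = c * ddvvIp X Z := by
  simp only [ddvvIp, Matrix.smul_apply, smul_eq_mul, mul_assoc, Finset.mul_sum]

theorem ddvvIp_add_right (X Y Z : Matrix (Fin r) (Fin r) ℝ) :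
    ddvvIp Z (X + Y) = ddvvIp Z X + ddvvIp Z Y := by
  simp only [ddvvIp_comm Z, ddvvIp_add_left]

theorem ddvvIp_sub_right (X Y Z : Matrix (Fin r) (Fin r) ℝ) :
    ddvvIp Z (X - Y) = ddvvIp Z X - ddvvIp Z Y := by
  simp only [ddvvIp_comm Z, ddvvIp_sub_left]

theorem ddvvIp_smul_right (c : ℝ) (X Z : Matrix (Fin r) (Fin r) ℝ) :
    ddvvIp Z (c • X) = c * ddvvIp Z X := by
  simp only [ddvvIp_comm Z, ddvvIp_smul_left]

theorem ddvvIp_zero_left (Z : Matrix (Fin r) (Fin r) ℝ) : ddvvIp 0 Z = 0 := by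
  simp [ddvvIp]

theorem ddvvIp_sum_left (u : Fin n → ℝ) (A : Fin n → Matrix (Fin r) (Fin r) ℝ)
    (Z : Matrix (Fin r) (Fin r) ℝ) :
    ddvvIp (∑ α, u α • A α) Z = ∑ α, u α * ddvvIp (A α) Z := by
  have : ∀ s : Finset (Fin n), ddvvIp (∑ α ∈ s, u α • A α) Z = ∑ α ∈ s, u α * ddvvIp (A α) Z := by
    intro s
    induction s using Finset.induction_on with
    | empty => simp [ddvvIp_zero_left]
    | insert a s ha ih =>
      rw [Finset.sum_insert ha, Finset.sum_insert ha, ddvvIp_add_left, ih, ddvvIp_smul_left]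
  exact this _

theorem ddvvIp_self_nonneg (X : Matrix (Fin r) (Fin r) ℝ) : 0 ≤ ddvvIp X X :=
  Finset.sum_nonneg fun _ _ => Finset.sum_nonneg fun _ _ => mul_self_nonneg _

theorem ddvvIp_self_eq_zero (X : Matrix (Fin r) (Fin r) ℝ) (h : ddvvIp X X = 0) : X = 0 := by
  ext i j
  have h1 := (Finset.sum_eq_zero_iff_of_nonneg
    (fun i _ => Finset.sum_nonneg fun j _ => mul_self_nonneg (X i j))).1 h i (Finset.mem_univ _)
  have h2 := (Finset.sum_eq_zero_iff_of_nonneg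
    (fun j _ => mul_self_nonneg (X i j))).1 h1 j (Finset.mem_univ _)
  simpa using h2

theorem ddvvIp_cs (X Y : Matrix (Fin r) (Fin r) ℝ) :
    ddvvIp X Y ^ 2 ≤ ddvvIp X X * ddvvIp Y Y := by
  have h := Finset.sum_mul_sq_le_sq_mul_sq (Finset.univ : Finset (Fin r × Fin r))
    (fun e => X e.1 e.2) (fun e => Y e.1 e.2)
  simp only [Fintype.sum_prod_type, sq (X _ _), sq (Y _ _)] at h
  exact h

theorem ddvvC_sum_left (u : Fin n → ℝ) (A : Fin n → Matrix (Fin r) (Fin r) ℝ)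
    (Z : Matrix (Fin r) (Fin r) ℝ) :
    ddvvC (∑ α, u α • A α) Z = ∑ α, u α • ddvvC (A α) Z := by
  simp only [ddvvC, Finset.sum_mul, Finset.mul_sum, smul_sub, Finset.sum_sub_distrib,
    Matrix.smul_mul, Matrix.mul_smul]

theorem ddvvC_swap (X Y : Matrix (Fin r) (Fin r) ℝ) : ddvvC X Y = - ddvvC Y X := by
  simp [ddvvC]

theorem ddvvC_smul (a b : ℝ) (X Y : Matrix (Fin r) (Fin r) ℝ) :
    ddvvC (a • X) (b • Y) = (a * b) • ddvvC X Y := by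
  simp only [ddvvC, Matrix.smul_mul, Matrix.mul_smul, smul_smul, smul_sub, mul_comm]

theorem ddvvIp_conj (U X Y : Matrix (Fin r) (Fin r) ℝ) (hU : U * U.transpose = 1) :
    ddvvIp (U.transpose * X * U) (U.transpose * Y * U) = ddvvIp X Y := by
  rw [ddvvIp_trace, ddvvIp_trace]
  simp only [Matrix.transpose_mul, Matrix.transpose_transpose]
  have : U.transpose * (X.transpose * U) * (U.transpose * Y * U)
      = U.transpose * (X.transpose * (U * U.transpose) * Y * U) := by
    simp only [Matrix.mul_assoc]
  rw [this, hU, Matrix.trace_mul_comm, Matrix.mul_assoc, hU]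
  simp

theorem ddvvC_conj (U X Y : Matrix (Fin r) (Fin r) ℝ) (hU : U * U.transpose = 1) :
    ddvvC (U.transpose * X * U) (U.transpose * Y * U) = U.transpose * ddvvC X Y * U := by
  have : ∀ X Y : Matrix (Fin r) (Fin r) ℝ,
      (U.transpose * X * U) * (U.transpose * Y * U) = U.transpose * (X * Y) * U := by
    intro X Y
    have : (U.transpose * X * U) * (U.transpose * Y * U)
       = U.transpose * X * (U * U.transpose) * Y * U := by simp only [Matrix.mul_assoc]
    rw [this, hU]; simp only [Matrix.mul_assoc, Matrix.one_mul]
  rw [ddvvC, this, this, ddvvC, Matrix.mul_sub, Matrix.sub_mul]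

theorem ddvv_diag (η : Fin r → ℝ) (X : Fin n → Matrix (Fin r) (Fin r) ℝ)
    (hX : ∀ β, (X β).IsSymm) (K : ℝ) (hK : 0 ≤ K)
    (h : ∀ E, ∑ β, ddvvIp (X β) E ^ 2 ≤ K * ddvvIp E E) :
    ∑ β, ddvvIp (ddvvC (Matrix.diagonal η) (X β)) (ddvvC (Matrix.diagonal η) (X β))
      ≤ ddvvIp (Matrix.diagonal η) (Matrix.diagonal η) * (∑ β, ddvvIp (X β) (X β) + K) := by
  have hd : ddvvIp (Matrix.diagonal η) (Matrix.diagonal η) = ∑ k, η k ^ 2 := by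
    simp [ddvvIp, Matrix.diagonal_apply, sq]
  have hw := ddvv_weight η (fun i j => ∑ β, X β i j ^ 2) K hK
    (fun i j => Finset.sum_nonneg fun _ _ => sq_nonneg _)
    (fun i j => Finset.sum_congr rfl fun β _ => by rw [(hX β).apply])
    (by
      intro i j hij
      have := h (Matrix.single i j 1 + Matrix.single j i 1)
      have h1 : ∀ (Y : Matrix (Fin r) (Fin r) ℝ) i j, ddvvIp Y (Matrix.single i j 1) = Y i j := by
        intro Y i j
        simp [ddvvIp, Matrix.single_apply, ite_and]
      simp only [ddvvIp_add_right, h1, Matrix.add_apply, Matrix.single_apply, (hX _).apply i j] at this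
      simp [hij.ne, hij.ne'] at this
      have h2 : ∑ β, (X β i j + X β i j) ^ 2 = 4 * ∑ β, X β i j ^ 2 := by
        rw [Finset.mul_sum]; exact Finset.sum_congr rfl fun _ _ => by ring
      rw [h2] at this
      linarith)
  rw [hd]
  convert hw using 1
  · simp only [ddvvIp, ddvvC, Matrix.sub_apply, Matrix.diagonal_mul, Matrix.mul_diagonal, Finset.mul_sum]
    rw [Finset.sum_comm]
    refine Finset.sum_congr rfl fun i _ => ?_
    rw [Finset.sum_comm]
    exact Finset.sum_congr rfl fun j _ => Finset.sum_congr rfl fun β _ => by ring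
  · congr 2
    simp only [ddvvIp]
    rw [Finset.sum_comm]
    refine Finset.sum_congr rfl fun i _ => ?_
    rw [Finset.sum_comm]
    exact Finset.sum_congr rfl fun j _ => Finset.sum_congr rfl fun β _ => by ring

theorem ddvv_gen (B : Matrix (Fin r) (Fin r) ℝ) (hB : B.IsSymm)
    (X : Fin n → Matrix (Fin r) (Fin r) ℝ)
    (hX : ∀ β, (X β).IsSymm) (K : ℝ) (hK : 0 ≤ K)
    (h : ∀ E, ∑ β, ddvvIp (X β) E ^ 2 ≤ K * ddvvIp E E) :
    ∑ β, ddvvIp (ddvvC B (X β)) (ddvvC B (X β))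
      ≤ ddvvIp B B * (∑ β, ddvvIp (X β) (X β) + K) := by
  have hBH : B.IsHermitian := by
    rw [Matrix.IsHermitian, Matrix.conjTranspose_eq_transpose_of_trivial]; exact hB
  obtain ⟨U, η, hU, hU', hD⟩ : ∃ (U : Matrix (Fin r) (Fin r) ℝ) (η : Fin r → ℝ),
      U * U.transpose = 1 ∧ U.transpose * U = 1 ∧ U.transpose * B * U = Matrix.diagonal η := by
    refine ⟨hBH.eigenvectorUnitary, hBH.eigenvalues, ?_, ?_, ?_⟩
    · have := Unitary.mul_star_self_of_mem hBH.eigenvectorUnitary.2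
      rwa [Matrix.star_eq_conjTranspose, Matrix.conjTranspose_eq_transpose_of_trivial] at this
    · have := Unitary.star_mul_self_of_mem hBH.eigenvectorUnitary.2
      rwa [Matrix.star_eq_conjTranspose, Matrix.conjTranspose_eq_transpose_of_trivial] at this
    · have := hBH.conjStarAlgAut_star_eigenvectorUnitary
      rw [Unitary.conjStarAlgAut_apply] at this
      simpa [Matrix.star_eq_conjTranspose, Matrix.conjTranspose_eq_transpose_of_trivial,
        Function.comp_def] using this
  have := ddvv_diag η (fun β => U.transpose * X β * U)
    (fun β => by
      rw [Matrix.IsSymm, Matrix.transpose_mul, Matrix.transpose_mul, Matrix.transpose_transpose,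
        (hX β).eq, Matrix.mul_assoc]) K hK
    (by
      intro E
      have h1 := h (U * E * U.transpose)
      have hE : U.transpose * (U * E * U.transpose) * U = E := by
        have : U.transpose * (U * E * U.transpose) * U
          = (U.transpose * U) * E * (U.transpose * U) := by simp only [Matrix.mul_assoc]
        rw [this, hU']; simp
      have h2 : ∀ β, ddvvIp (U.transpose * X β * U) E = ddvvIp (X β) (U * E * U.transpose) := by
        intro β
        rw [← ddvvIp_conj U (X β) _ hU, hE]
      have h3 : ddvvIp E E = ddvvIp (U * E * U.transpose) (U * E * U.transpose) := by
        rw [← ddvvIp_conj U (U * E * U.transpose) _ hU, hE]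
      simp only [h2, h3]
      exact h1)
  rw [← hD] at this
  simpa only [ddvvC_conj U _ _ hU, ddvvIp_conj U _ _ hU] using this

theorem ddvv_var (u : Fin n → ℝ) (hu : ∑ α, u α ^ 2 = 1) (X : Fin n → Matrix (Fin r) (Fin r) ℝ)
    (hX : ∑ α, u α • X α = 0) (B : Matrix (Fin r) (Fin r) ℝ) (s : ℝ) :
    ∑ α, ∑ β, ddvvIp (ddvvC (X α + (s * u α) • B) (X β + (s * u β) • B))
        (ddvvC (X α + (s * u α) • B) (X β + (s * u β) • B))
      = ∑ α, ∑ β, ddvvIp (ddvvC (X α) (X β)) (ddvvC (X α) (X β))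
        + 2 * s ^ 2 * ∑ β, ddvvIp (ddvvC B (X β)) (ddvvC B (X β)) := by
  have hexp : ∀ α β, ddvvC (X α + (s * u α) • B) (X β + (s * u β) • B)
      = ddvvC (X α) (X β) + s • (u α • ddvvC B (X β) - u β • ddvvC B (X α)) := by
    intro α β
    simp only [ddvvC, add_mul, mul_add, Matrix.smul_mul, Matrix.mul_smul]
    module
  have hC : ∑ α, u α • ddvvC B (X α) = 0 := by
    have := ddvvC_sum_left u X B
    rw [hX] at this
    simp only [fun α => ddvvC_swap B (X α), smul_neg, Finset.sum_neg_distrib, ← this]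
    simp [ddvvC]
  have c1 : ∀ β, ∑ α, u α * ddvvIp (ddvvC (X α) (X β)) (ddvvC B (X β)) = 0 := by
    intro β
    rw [← ddvvIp_sum_left u (fun α => ddvvC (X α) (X β)), ← ddvvC_sum_left, hX]
    simp [ddvvC, ddvvIp]
  have c2 : ∀ β, ∑ α, u α * ddvvIp (ddvvC B (X α)) (ddvvC B (X β)) = 0 := by
    intro β
    rw [← ddvvIp_sum_left u (fun α => ddvvC B (X α)), hC, ddvvIp_zero_left]
  have hterm : ∀ α β, ddvvIp (ddvvC (X α + (s * u α) • B) (X β + (s * u β) • B))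
        (ddvvC (X α + (s * u α) • B) (X β + (s * u β) • B))
      = ddvvIp (ddvvC (X α) (X β)) (ddvvC (X α) (X β))
        + 2 * s * (u α * ddvvIp (ddvvC (X α) (X β)) (ddvvC B (X β)))
        + 2 * s * (u β * ddvvIp (ddvvC (X β) (X α)) (ddvvC B (X α)))
        + s ^ 2 * (u α ^ 2 * ddvvIp (ddvvC B (X β)) (ddvvC B (X β)))
        + s ^ 2 * (u β ^ 2 * ddvvIp (ddvvC B (X α)) (ddvvC B (X α)))
        - 2 * s ^ 2 * (u β * (u α * ddvvIp (ddvvC B (X α)) (ddvvC B (X β)))) := by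
    intro α β
    have hs : ddvvIp (ddvvC (X β) (X α)) (ddvvC B (X α))
        = - ddvvIp (ddvvC (X α) (X β)) (ddvvC B (X α)) := by
      rw [ddvvC_swap (X β), ← neg_one_smul ℝ, ddvvIp_smul_left]; ring
    rw [hexp, hs]
    simp only [ddvvIp_add_left, ddvvIp_add_right, ddvvIp_sub_left, ddvvIp_sub_right,
      ddvvIp_smul_left, ddvvIp_smul_right]
    rw [ddvvIp_comm (ddvvC B (X β)) (ddvvC (X α) (X β)),
      ddvvIp_comm (ddvvC B (X α)) (ddvvC (X α) (X β)),
      ddvvIp_comm (ddvvC B (X β)) (ddvvC B (X α))]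
    ring
  simp only [hterm, Finset.sum_add_distrib, Finset.sum_sub_distrib]
  have d1 : ∑ α, ∑ β, 2 * s * (u α * ddvvIp (ddvvC (X α) (X β)) (ddvvC B (X β))) = 0 := by
    rw [Finset.sum_comm]; simp only [← Finset.mul_sum, c1]; simp
  have d2 : ∑ α, ∑ β, 2 * s * (u β * ddvvIp (ddvvC (X β) (X α)) (ddvvC B (X α))) = 0 := by
    simp only [← Finset.mul_sum, c1]; simp
  have d3 : ∑ α, ∑ β, s ^ 2 * (u α ^ 2 * ddvvIp (ddvvC B (X β)) (ddvvC B (X β)))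
      = s ^ 2 * ∑ β, ddvvIp (ddvvC B (X β)) (ddvvC B (X β)) := by
    simp only [← Finset.mul_sum, ← Finset.sum_mul, hu, one_mul]
  have d4 : ∑ α, ∑ β, s ^ 2 * (u β ^ 2 * ddvvIp (ddvvC B (X α)) (ddvvC B (X α)))
      = s ^ 2 * ∑ β, ddvvIp (ddvvC B (X β)) (ddvvC B (X β)) := by
    rw [Finset.sum_comm]; exact d3
  have d5 : ∑ α, ∑ β, 2 * s ^ 2 * (u β * (u α * ddvvIp (ddvvC B (X α)) (ddvvC B (X β)))) = 0 := by
    rw [Finset.sum_comm]; simp only [← Finset.mul_sum, c2]; simp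
  rw [d1, d2, d3, d4, d5]
  ring

theorem ddvv_top (A : Fin n → Matrix (Fin r) (Fin r) ℝ) (hn : 0 < n) :
    ∃ u : Fin n → ℝ, ∑ α, u α ^ 2 = 1 ∧ ∀ v : Fin n → ℝ,
      ddvvIp (∑ α, v α • A α) (∑ α, v α • A α)
        ≤ ddvvIp (∑ α, u α • A α) (∑ α, u α • A α) * ∑ α, v α ^ 2 := by
  set q : (Fin n → ℝ) → ℝ := fun v => ddvvIp (∑ α, v α • A α) (∑ α, v α • A α) with hq
  have hqs : ∀ (c : ℝ) v, q (fun α => c * v α) = c ^ 2 * q v := by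
    intro c v
    simp only [hq, mul_smul, ← Finset.smul_sum, ddvvIp_smul_left, ddvvIp_smul_right]
    ring
  have hqc : Continuous q := by
    simp only [hq, ddvvIp, Matrix.sum_apply, Matrix.smul_apply]
    fun_prop
  have hcomp : IsCompact {v : Fin n → ℝ | ∑ α, v α ^ 2 = 1} := by
    refine (isCompact_univ_pi fun _ => isCompact_Icc (a := (-1 : ℝ)) (b := 1)).of_isClosed_subset
      (isClosed_eq (by fun_prop) continuous_const) ?_
    intro v hv α _
    have : v α ^ 2 ≤ 1 := by
      rw [← (show ∑ α, v α ^ 2 = 1 from hv)]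
      exact Finset.single_le_sum (f := fun α => v α ^ 2) (fun _ _ => sq_nonneg _) (Finset.mem_univ α)
    exact abs_le.1 ((sq_le_one_iff_abs_le_one _).1 this)
  have hne : {v : Fin n → ℝ | ∑ α, v α ^ 2 = 1}.Nonempty := by
    refine ⟨Pi.single ⟨0, hn⟩ 1, ?_⟩
    simp [Pi.single_apply]
  obtain ⟨u, hu, hmax⟩ := hcomp.exists_isMaxOn hne hqc.continuousOn
  refine ⟨u, hu, fun v => ?_⟩
  change q v ≤ q u * _
  set S := ∑ α, v α ^ 2 with hS
  have hS0 : 0 ≤ S := Finset.sum_nonneg fun _ _ => sq_nonneg _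
  rcases hS0.eq_or_lt with h | h
  · have hv : ∀ α, v α = 0 := by
      intro α
      have := (Finset.sum_eq_zero_iff_of_nonneg (fun α _ => sq_nonneg (v α))).1 h.symm α
        (Finset.mem_univ _)
      simpa using this
    rw [← h]
    simp [hq, hv, ddvvIp]
  · have h1 : (Real.sqrt S)⁻¹ ^ 2 * S = 1 := by
      rw [inv_pow, Real.sq_sqrt hS0]; field_simp
    have hm : q (fun α => (Real.sqrt S)⁻¹ * v α) ≤ q u := hmax (by
      simp only [Set.mem_ofPred_eq, mul_pow, ← Finset.mul_sum]
      exact h1)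
    rw [hqs] at hm
    calc q v = ((Real.sqrt S)⁻¹ ^ 2 * S) * q v := by rw [h1, one_mul]
      _ = ((Real.sqrt S)⁻¹ ^ 2 * q v) * S := by ring
      _ ≤ q u * S := by gcongr

/-- Total squared norm. -/
def ddvvN (A : Fin n → Matrix (Fin r) (Fin r) ℝ) : ℝ := ∑ α, ddvvIp (A α) (A α)

/-- Total squared commutator norm. -/
def ddvvF (A : Fin n → Matrix (Fin r) (Fin r) ℝ) : ℝ :=
  ∑ α, ∑ β, ddvvIp (ddvvC (A α) (A β)) (ddvvC (A α) (A β))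

theorem ddvv_crit (A : Fin n → Matrix (Fin r) (Fin r) ℝ) (hA : ∀ β, (A β).IsSymm) (c : ℝ)
    (hN : ddvvN A = 1) (hF : ddvvF A = c)
    (hmax : ∀ A' : Fin n → Matrix (Fin r) (Fin r) ℝ, (∀ β, (A' β).IsSymm) →
      ddvvF A' ≤ c * ddvvN A' ^ 2) : c ≤ 1 := by
  have hn : 0 < n := by
    rcases Nat.eq_zero_or_pos n with h | h
    · subst h; simp [ddvvN] at hN
    · exact h
  obtain ⟨u, hu, htop⟩ := ddvv_top A hn
  set B := ∑ α, u α • A α with hB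
  set l := ddvvIp B B with hl
  have hl0 : 0 ≤ l := ddvvIp_self_nonneg B
  have hBs : B.IsSymm := by
    rw [Matrix.IsSymm, hB, Matrix.transpose_sum]
    exact Finset.sum_congr rfl fun α _ => by rw [Matrix.transpose_smul, (hA α).eq]
  set X : Fin n → Matrix (Fin r) (Fin r) ℝ := fun β => A β - u β • B with hX
  have hXs : ∀ β, (X β).IsSymm := by
    intro β
    rw [Matrix.IsSymm, hX, Matrix.transpose_sub, Matrix.transpose_smul, (hA β).eq, hBs.eq]
  have huX : ∑ α, u α • X α = 0 := by
    simp only [hX, smul_sub, Finset.sum_sub_distrib, smul_smul, ← Finset.sum_smul, ← sq, hu]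
    rw [← hB]; simp
  have hAX : A = fun β => X β + ((1 : ℝ) * u β) • B := by
    funext β; simp [hX]
  have hNs : ∀ s : ℝ, ddvvN (fun β => X β + (s * u β) • B) = ddvvN X + s ^ 2 * l := by
    intro s
    have h1 : ∑ β, u β * ddvvIp (X β) B = 0 := by
      rw [← ddvvIp_sum_left, huX, ddvvIp_zero_left]
    have h2 : ∀ β, ddvvIp (X β + (s * u β) • B) (X β + (s * u β) • B)
        = ddvvIp (X β) (X β) + 2 * s * (u β * ddvvIp (X β) B) + s ^ 2 * l * u β ^ 2 := by
      intro β
      simp only [ddvvIp_add_left, ddvvIp_add_right, ddvvIp_smul_left, ddvvIp_smul_right]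
      rw [ddvvIp_comm B (X β)]
      ring
    simp only [ddvvN, h2, Finset.sum_add_distrib, ← Finset.mul_sum, h1, hu]
    ring
  set Q := ∑ β, ddvvIp (ddvvC B (X β)) (ddvvC B (X β)) with hQ
  have hFs : ∀ s : ℝ, ddvvF (fun β => X β + (s * u β) • B) = ddvvF X + 2 * s ^ 2 * Q :=
    fun s => ddvv_var u hu X huX B s
  have hN1 : ddvvN X + l = 1 := by
    have := hNs 1
    rw [← hAX, hN] at this
    linarith
  have hF1 : ddvvF X + 2 * Q = c := by
    have := hFs 1
    rw [← hAX, hF] at this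
    linarith
  have hNX0 : 0 ≤ ddvvN X := Finset.sum_nonneg fun _ _ => ddvvIp_self_nonneg _
  have hlpos : 0 < l := by
    rcases hl0.eq_or_lt with h | h
    · exfalso
      have : ddvvN A ≤ 0 := by
        refine Finset.sum_nonpos fun β _ => ?_
        have := htop (Pi.single β 1)
        rw [← h] at this
        simpa [Pi.single_apply, ite_smul] using this
      linarith
    · exact h
  have hBes : ∀ E, ∑ β, ddvvIp (A β) E ^ 2 ≤ l * ddvvIp E E := by
    intro E
    set S := ∑ β, ddvvIp (A β) E ^ 2 with hS
    have hS0 : 0 ≤ S := Finset.sum_nonneg fun _ _ => sq_nonneg _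
    have h1 : ddvvIp (∑ β, ddvvIp (A β) E • A β) E = S := by
      rw [ddvvIp_sum_left]
      exact Finset.sum_congr rfl fun _ _ => by ring
    have h2 := ddvvIp_cs (∑ β, ddvvIp (A β) E • A β) E
    rw [h1] at h2
    have h3 := htop (fun β => ddvvIp (A β) E)
    have hE := ddvvIp_self_nonneg E
    have h4 : S ^ 2 ≤ l * S * ddvvIp E E := h2.trans (by gcongr)
    rcases hS0.eq_or_lt with h | h
    · rw [← h]; positivity
    · nlinarith
  have hBesX : ∀ E, ∑ β, ddvvIp (X β) E ^ 2 ≤ l * ddvvIp E E := by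
    intro E
    refine le_trans ?_ (hBes E)
    have hb : ∑ β, u β * ddvvIp (A β) E = ddvvIp B E := by rw [hB, ddvvIp_sum_left]
    have : ∑ β, ddvvIp (X β) E ^ 2 = ∑ β, ddvvIp (A β) E ^ 2 - ddvvIp B E ^ 2 := by
      have h2 : ∀ β, ddvvIp (X β) E ^ 2 = ddvvIp (A β) E ^ 2
          - 2 * ddvvIp B E * (u β * ddvvIp (A β) E) + ddvvIp B E ^ 2 * u β ^ 2 := by
        intro β
        simp only [hX, ddvvIp_sub_left, ddvvIp_smul_left]; ring
      simp only [h2, Finset.sum_add_distrib, Finset.sum_sub_distrib, ← Finset.mul_sum, hb, hu]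
      ring
    rw [this]
    nlinarith [sq_nonneg (ddvvIp B E)]
  have hQl : Q ≤ l := by
    have := ddvv_gen B hBs X hXs l hl0 hBesX
    rw [show ∑ β, ddvvIp (X β) (X β) = ddvvN X from rfl, hN1] at this
    linarith
  by_contra hc
  push Not at hc
  have hm := hmax (fun β => X β + (Real.sqrt (1 / c) * u β) • B) (by
    intro β
    rw [Matrix.IsSymm, Matrix.transpose_add, Matrix.transpose_smul, (hXs β).eq, hBs.eq])
  rw [hFs, hNs, mul_assoc, Real.sq_sqrt (by positivity)] at hm
  set t := 1 / c with ht
  have htc : t * c = 1 := by rw [ht]; field_simp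
  have ht1 : t < 1 := by rw [ht, div_lt_one (by linarith)]; exact hc
  have e1 : ddvvN X = 1 - l := by linarith
  have e2 : ddvvF X = c - 2 * Q := by linarith
  rw [e1, e2] at hm
  have hm2 : 2 * (1 - t) * Q ≥ (1 - t) * (c * (2 * l - (1 - t) * l ^ 2)) := by nlinarith
  have hm3 : 2 * Q ≥ c * (2 * l - (1 - t) * l ^ 2) := by
    by_contra hh
    push Not at hh
    have : 0 < 1 - t := by linarith
    nlinarith
  have hm4 : 2 ≥ c * (2 - (1 - t) * l) := by
    by_contra hh
    push Not at hh
    nlinarith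
  have hl1 : l ≤ 1 := by linarith
  have : c * (2 - (1 - t) * l) = 2 * c - (c - 1) * l := by
    linear_combination l * htc
  nlinarith

theorem ddvv_scale (c : ℝ)
    (h : ∀ A : Fin n → Matrix (Fin r) (Fin r) ℝ, (∀ β, (A β).IsSymm) → ddvvN A = 1 → ddvvF A ≤ c)
    (A : Fin n → Matrix (Fin r) (Fin r) ℝ) (hA : ∀ β, (A β).IsSymm) :
    ddvvF A ≤ c * ddvvN A ^ 2 := by
  have hN0 : 0 ≤ ddvvN A := Finset.sum_nonneg fun _ _ => ddvvIp_self_nonneg _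
  rcases hN0.eq_or_lt with h0 | h0
  · have hz : ∀ β, A β = 0 := by
      intro β
      exact ddvvIp_self_eq_zero _ ((Finset.sum_eq_zero_iff_of_nonneg
        (fun α _ => ddvvIp_self_nonneg (A α))).1 h0.symm β (Finset.mem_univ _))
    rw [← h0]
    simp [ddvvF, hz, ddvvC, ddvvIp]
  · set N := ddvvN A with hN
    set k := (Real.sqrt N)⁻¹ with hk
    have hkN : k ^ 2 * N = 1 := by
      rw [hk, inv_pow, Real.sq_sqrt hN0]; field_simp
    have h1 := h (fun β => k • A β) (fun β => by
      rw [Matrix.IsSymm, Matrix.transpose_smul, (hA β).eq]) (by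
      rw [← hkN, hN]
      simp only [ddvvN, ddvvIp_smul_left, ddvvIp_smul_right, Finset.mul_sum]
      exact Finset.sum_congr rfl fun _ _ => by ring)
    have h2 : ddvvF (fun β => k • A β) = k ^ 4 * ddvvF A := by
      simp only [ddvvF, ddvvC_smul, ddvvIp_smul_left, ddvvIp_smul_right, Finset.mul_sum]
      exact Finset.sum_congr rfl fun _ _ => Finset.sum_congr rfl fun _ _ => by ring
    rw [h2] at h1
    calc ddvvF A = (k ^ 2 * N) ^ 2 * ddvvF A := by rw [hkN]; ring
      _ = k ^ 4 * ddvvF A * N ^ 2 := by ring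
      _ ≤ c * N ^ 2 := by gcongr

theorem ddvv_main (A : Fin n → Matrix (Fin r) (Fin r) ℝ) (hA : ∀ β, (A β).IsSymm) :
    ddvvF A ≤ ddvvN A ^ 2 := by
  set K : Set (Fin n → Matrix (Fin r) (Fin r) ℝ) := {A | (∀ β, (A β).IsSymm) ∧ ddvvN A = 1} with hK
  have key : ∀ A' ∈ K, ddvvF A' ≤ 1 := by
    intro A' hA'
    have hcN : Continuous (fun A : Fin n → Matrix (Fin r) (Fin r) ℝ => ddvvN A) := by
      simp only [ddvvN, ddvvIp]
      fun_prop
    have hcF : Continuous (fun A : Fin n → Matrix (Fin r) (Fin r) ℝ => ddvvF A) := by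
      simp only [ddvvF, ddvvC, ddvvIp, Matrix.sub_apply, Matrix.mul_apply]
      fun_prop
    have hcl : IsClosed K := by
      have hK2 : K = (⋂ β, {A : Fin n → Matrix (Fin r) (Fin r) ℝ | (A β).transpose = A β})
          ∩ {A | ddvvN A = 1} := by
        ext A
        simp [hK, Matrix.IsSymm]
      rw [hK2]
      refine IsClosed.inter ?_ (isClosed_eq hcN continuous_const)
      exact isClosed_iInter fun β =>
        isClosed_eq ((continuous_apply β).matrix_transpose) (continuous_apply β)
    have hbox : IsCompact {A : Fin n → Matrix (Fin r) (Fin r) ℝ |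
        ∀ α ∈ Set.univ, A α ∈ Set.pi Set.univ fun _ : Fin r =>
          Set.pi Set.univ fun _ : Fin r => Set.Icc (-1 : ℝ) 1} :=
      isCompact_univ_pi fun _ => isCompact_univ_pi fun _ => isCompact_univ_pi fun _ => isCompact_Icc
    have hcomp : IsCompact K := by
      refine hbox.of_isClosed_subset hcl ?_
      intro A hA α _ i _ j _
      have h1 : A α i j * A α i j ≤ 1 := by
        calc _ ≤ ∑ j, A α i j * A α i j :=
              Finset.single_le_sum (f := fun j => A α i j * A α i j)
                (fun _ _ => mul_self_nonneg _) (Finset.mem_univ j)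
          _ ≤ ddvvIp (A α) (A α) :=
              Finset.single_le_sum (f := fun i => ∑ j, A α i j * A α i j)
                (fun _ _ => Finset.sum_nonneg fun _ _ => mul_self_nonneg _) (Finset.mem_univ i)
          _ ≤ ddvvN A :=
              Finset.single_le_sum (f := fun α => ddvvIp (A α) (A α))
                (fun _ _ => ddvvIp_self_nonneg _) (Finset.mem_univ α)
          _ = 1 := hA.2
      rw [← sq] at h1
      exact abs_le.1 ((sq_le_one_iff_abs_le_one _).1 h1)
    obtain ⟨M, hM, hmax⟩ := hcomp.exists_isMaxOn ⟨A', hA'⟩ hcF.continuousOn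
    have := ddvv_crit M hM.1 (ddvvF M) hM.2 rfl
      (ddvv_scale _ fun A h1 h2 => hmax ⟨h1, h2⟩)
    exact (hmax hA').trans this
  have := ddvv_scale 1 (fun A h1 h2 => key A ⟨h1, h2⟩) A hA
  linarith

end

/-- Inequality (3.13)/(3.11) of the paper in matrix form: the normalized
commutator term is bounded by the normalized DDVV left-hand side. -/
theorem stmt7 (r n : ℕ) (hr : 2 ≤ r) (A : Fin n → Matrix (Fin r) (Fin r) ℝ)
    (hA : ∀ β, (A β).IsSymm) :
    (2 / ((r : ℝ) * ((r : ℝ) - 1))) * Real.sqrt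
        (∑ β : Fin n, ∑ γ : Fin n, if β < γ then
          ∑ i : Fin r, ∑ j : Fin r, if i < j then
            ((A γ * A β - A β * A γ) i j) ^ 2
          else 0
        else 0)
    ≤ (1 / ((r : ℝ) ^ 2 * ((r : ℝ) - 1))) *
        ((∑ β : Fin n, ∑ i : Fin r, ∑ j : Fin r,
            if i < j then (A β i i - A β j j) ^ 2 else 0)
          + 2 * (r : ℝ) * ∑ β : Fin n, ∑ i : Fin r, ∑ j : Fin r,
              if i < j then (A β i j) ^ 2 else 0) := by
  have hr2 : (2 : ℝ) ≤ r := by exact_mod_cast hr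
  set X : Fin n → Matrix (Fin r) (Fin r) ℝ :=
    fun β => A β - ((A β).trace / r) • (1 : Matrix (Fin r) (Fin r) ℝ) with hX
  have hXs : ∀ β, (X β).IsSymm := by
    intro β
    rw [Matrix.IsSymm, hX, Matrix.transpose_sub, Matrix.transpose_smul, (hA β).eq,
      Matrix.transpose_one]
  have hC : ∀ β γ, ddvvC (X β) (X γ) = A β * A γ - A γ * A β := by
    intro β γ
    simp only [ddvvC, hX, sub_mul, mul_sub, Matrix.smul_mul, Matrix.mul_smul, Matrix.one_mul,
      Matrix.mul_one]
    module
  have hmain := ddvv_main X hXs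
  set T := ∑ β : Fin n, ∑ γ : Fin n, (if β < γ then
          ∑ i : Fin r, ∑ j : Fin r, if i < j then
            ((A γ * A β - A β * A γ) i j) ^ 2
          else 0
        else 0) with hT
  have hskew : ∀ β γ i j, (A γ * A β - A β * A γ) i j = - (A γ * A β - A β * A γ) j i := by
    intro β γ i j
    have : (A γ * A β - A β * A γ).transpose = - (A γ * A β - A β * A γ) := by
      rw [Matrix.transpose_sub, Matrix.transpose_mul, Matrix.transpose_mul, (hA β).eq, (hA γ).eq]
      abel
    have h2 := congrFun (congrFun this j) i
    simpa [Matrix.transpose_apply] using h2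
  have hF : ddvvF X = 4 * T := by
    have h1 : ∀ β γ, ddvvIp (ddvvC (X β) (X γ)) (ddvvC (X β) (X γ))
        = 2 * ∑ i : Fin r, ∑ j : Fin r, if i < j then ((A γ * A β - A β * A γ) i j) ^ 2 else 0 := by
      intro β γ
      rw [ddvvC_swap, ← neg_one_smul ℝ, ddvvIp_smul_left, ddvvIp_smul_right, hC, ddvvIp]
      simp only [← sq]
      rw [ddvv_sum_symm _ (fun i j => by rw [hskew β γ i j, neg_sq])]
      have : ∀ i, (A γ * A β - A β * A γ) i i = 0 := fun i => by
        have := hskew β γ i i; linarith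
      simp only [this]
      simp
    rw [ddvvF, ddvv_sum_symm]
    · simp only [h1]
      have h0 : ∀ β, ∑ i : Fin r, ∑ j : Fin r,
          (if i < j then ((A β * A β - A β * A β) i j) ^ 2 else 0) = 0 := by
        intro β; simp
      simp only [h0, hT]
      simp only [← mul_ite_zero, ← Finset.mul_sum]
      simp
      ring
    · intro β γ
      rw [ddvvC_swap, ← neg_one_smul ℝ, ddvvIp_smul_left, ddvvIp_smul_right]; ring
  have hN : (r : ℝ) * ddvvN X = (∑ β : Fin n, ∑ i : Fin r, ∑ j : Fin r,
            if i < j then (A β i i - A β j j) ^ 2 else 0)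
          + 2 * (r : ℝ) * ∑ β : Fin n, ∑ i : Fin r, ∑ j : Fin r,
              if i < j then (A β i j) ^ 2 else 0 := by
    rw [ddvvN, Finset.mul_sum, Finset.mul_sum, ← Finset.sum_add_distrib]
    refine Finset.sum_congr rfl fun β _ => ?_
    have e1 : ddvvIp (X β) (X β) = ddvvIp (A β) (A β) - (A β).trace ^ 2 / r := by
      have h1 : ddvvIp (A β) 1 = (A β).trace := by
        rw [ddvvIp_trace, (hA β).eq, Matrix.mul_one]
      have h2 : ddvvIp (1 : Matrix (Fin r) (Fin r) ℝ) 1 = r := by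
        rw [ddvvIp_trace]; simp
      simp only [hX, ddvvIp_sub_left, ddvvIp_sub_right, ddvvIp_smul_left, ddvvIp_smul_right]
      rw [ddvvIp_comm 1 (A β), h1, h2]
      field_simp
      ring
    have e2 := ddvv_sum_symm (fun i j => A β i j ^ 2) (fun i j => by rw [(hA β).apply])
    have e3 := ddvv_sum_symm (fun i j => (A β i i - A β j j) ^ 2) (fun i j => by ring)
    have e4 : ∑ i, ∑ j, (A β i i - A β j j) ^ 2 = 2 * r * ∑ i, A β i i ^ 2 - 2 * (A β).trace ^ 2 := by
      have : ∀ i j, (A β i i - A β j j) ^ 2 = A β i i ^ 2 + A β j j ^ 2 - 2 * (A β i i * A β j j) :=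
        fun i j => by ring
      simp only [this, Finset.sum_sub_distrib, Finset.sum_add_distrib, ← Finset.mul_sum,
        ← Finset.sum_mul]
      simp [Matrix.trace, ← Finset.mul_sum]
      ring
    have e5 : ddvvIp (A β) (A β) = ∑ i, ∑ j, A β i j ^ 2 := by simp only [ddvvIp, sq]
    simp only [sub_self] at e3
    rw [e4] at e3
    rw [e1, e5, e2]
    have : (r : ℝ) * ((A β).trace ^ 2 / r) = (A β).trace ^ 2 := by field_simp
    rw [mul_sub, this]
    simp at e3
    linarith
  rw [← hN]
  have hNX0 : 0 ≤ ddvvN X := Finset.sum_nonneg fun _ _ => ddvvIp_self_nonneg _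
  have hs : Real.sqrt T ≤ ddvvN X / 2 := by
    apply Real.sqrt_le_iff.2
    constructor
    · positivity
    · rw [hF] at hmain; nlinarith
  have hr1 : 0 < (r : ℝ) - 1 := by linarith
  calc _ ≤ 2 / ((r : ℝ) * ((r : ℝ) - 1)) * (ddvvN X / 2) := by gcongr
    _ = _ := by field_simp
end
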